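/- arXiv:2406.06411 — 3 statements merged into one kernel-verified Lean document; each statement's English description precedes it below -/
import Mathlib

section
/- Let h > 0, ξ ∈ ℝ, μ ∈ ℝ, and let f₀(t) = (πh)^{−1/4} e^{−(t+ξ)²/(2h)}. Suppose u₀ ∈ H²((0,∞)) is real-valued with (t+ξ)² u₀ ∈ L²((0,∞)), u₀′(0) = 0, and −h² u₀″(t) + (t+ξ)² u₀(t) = μ u₀(t) for all t > 0. Then (h − μ) ∫₀^∞ f₀(t) u₀(t) dt = h² f₀′(0) u₀(0), where f₀′(0) = −(ξ/h)(πh)^{−1/4} e^{−ξ²/(2h)}. -/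
open MeasureTheory Set

/-- The derivative of a shifted Gaussian. -/
theorem hasDerivAt_shifted_gaussian (c h xi t : ℝ) (hh : h ≠ 0) :
    HasDerivAt (fun t => c * Real.exp (-(t + xi) ^ 2 / (2 * h)))
      (-((t + xi) / h) * (c * Real.exp (-(t + xi) ^ 2 / (2 * h)))) t := by
  have h1 : HasDerivAt (fun t : ℝ => -(t + xi) ^ 2 / (2 * h)) (-((t + xi) / h)) t := by
    refine ((((hasDerivAt_id t).add_const xi).pow 2).neg.div_const (2 * h)).congr_deriv ?_
    simp
    field_simp
  exact (h1.exp.const_mul c).congr_deriv (by ring)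

theorem memLp_two_shifted_gaussian (c xi : ℝ) {h : ℝ} (hh : 0 < h) :
    MemLp (fun t : ℝ => c * Real.exp (-(t + xi) ^ 2 / (2 * h))) 2 := by
  rw [memLp_two_iff_integrable_sq (by fun_prop)]
  have h1 := ((integrable_exp_neg_mul_sq (inv_pos.2 hh)).comp_add_right xi).const_mul (c ^ 2)
  refine h1.congr (ae_of_all _ fun t => ?_)
  simp only [mul_pow, ← Real.exp_nat_mul]
  congr 2
  push_cast
  field_simp

theorem memLp_two_mul_shifted_gaussian (c xi : ℝ) {h : ℝ} (hh : 0 < h) :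
    MemLp (fun t : ℝ => -((t + xi) / h) * (c * Real.exp (-(t + xi) ^ 2 / (2 * h)))) 2 := by
  rw [memLp_two_iff_integrable_sq (by fun_prop)]
  have h0 := integrable_rpow_mul_exp_neg_mul_sq (inv_pos.2 hh) (s := 2) (by norm_num)
  have h1 := (h0.comp_add_right xi).const_mul (c ^ 2 / h ^ 2)
  refine h1.congr (ae_of_all _ fun t => ?_)
  simp only [mul_pow, ← Real.exp_nat_mul, Real.rpow_two]
  have h2 : ((2 : ℕ) : ℝ) * (-(t + xi) ^ 2 / (2 * h)) = -h⁻¹ * (t + xi) ^ 2 := by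
    push_cast
    field_simp
  rw [h2]
  ring

/-- Lagrange's identity: the derivative of the Wronskian of `f` and `u`. -/
theorem hasDerivAt_wronskian {f f' u u' : ℝ → ℝ} {f'' u'' t : ℝ}
    (hf : HasDerivAt f (f' t) t) (hf' : HasDerivAt f' f'' t)
    (hu : HasDerivAt u (u' t) t) (hu' : HasDerivAt u' u'' t) :
    HasDerivAt (fun t => f t * u' t - f' t * u t) (f t * u'' - f'' * u t) t := by
  exact ((hf.mul hu').sub (hf'.mul hu)).congr_deriv (by ring)

theorem neumann_boundary_identity (h xi mu : ℝ) (hh : 0 < h)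
    (f₀ u₀ : ℝ → ℝ)
    (hf₀ : f₀ = fun t => (Real.pi * h) ^ (-(1:ℝ)/4) * Real.exp (-(t + xi) ^ 2 / (2 * h)))
    -- `u₀ ∈ H²((0,∞))`, real-valued, with `(t+ξ)² u₀ ∈ L²((0,∞))`
    (hu₀ : Differentiable ℝ u₀) (hu₀' : Differentiable ℝ (deriv u₀))
    (hL2 : IntegrableOn (fun t => (u₀ t) ^ 2) (Set.Ioi 0))
    (hL2' : IntegrableOn (fun t => (deriv u₀ t) ^ 2) (Set.Ioi 0))
    (hL2'' : IntegrableOn (fun t => (deriv (deriv u₀) t) ^ 2) (Set.Ioi 0))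
    (hL2V : IntegrableOn (fun t => ((t + xi) ^ 2 * u₀ t) ^ 2) (Set.Ioi 0))
    -- Neumann boundary condition at `t = 0`
    (hNeu : deriv u₀ 0 = 0)
    -- eigenvalue equation on `(0,∞)`
    (hEq : ∀ t : ℝ, 0 < t →
      -h ^ 2 * deriv (deriv u₀) t + (t + xi) ^ 2 * u₀ t = mu * u₀ t) :
    (h - mu) * (∫ t in Set.Ioi (0:ℝ), f₀ t * u₀ t) = h ^ 2 * deriv f₀ 0 * u₀ 0 ∧
    deriv f₀ 0 = -(xi / h) * (Real.pi * h) ^ (-(1:ℝ)/4) * Real.exp (-xi ^ 2 / (2 * h)) := by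
  set c := (Real.pi * h) ^ (-(1:ℝ)/4)
  have hne := hh.ne'
  set g : ℝ → ℝ := fun t => -((t + xi) / h) * f₀ t
  have hf (t : ℝ) : HasDerivAt f₀ (g t) t := by
    simpa only [g, hf₀] using hasDerivAt_shifted_gaussian c h xi t hne
  have hg (t : ℝ) : HasDerivAt g (-(1 / h) * f₀ t + -((t + xi) / h) * g t) t :=
    ((((hasDerivAt_id t).add_const xi).div_const h).neg).mul (hf t)
  have hfL : MemLp f₀ 2 (volume.restrict (Ioi 0)) := by
    rw [hf₀]
    exact (memLp_two_shifted_gaussian c xi hh).restrict _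
  have hgL : MemLp g 2 (volume.restrict (Ioi 0)) := by
    simp only [g, hf₀]
    exact (memLp_two_mul_shifted_gaussian c xi hh).restrict _
  have huL : MemLp u₀ 2 (volume.restrict (Ioi 0)) :=
    (memLp_two_iff_integrable_sq hu₀.continuous.aestronglyMeasurable).2 hL2
  have huL' : MemLp (deriv u₀) 2 (volume.restrict (Ioi 0)) :=
    (memLp_two_iff_integrable_sq hu₀'.continuous.aestronglyMeasurable).2 hL2'
  set W : ℝ → ℝ := fun t => h ^ 2 * (f₀ t * deriv u₀ t - g t * u₀ t)
  have hW (t : ℝ) (ht : t ∈ Ioi 0) : HasDerivAt W ((h - mu) * (f₀ t * u₀ t)) t := by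
    refine ((hasDerivAt_wronskian (hf t) (hg t) (hu₀ t).hasDerivAt
      (hu₀' t).hasDerivAt).const_mul (h ^ 2)).congr_deriv ?_
    have e := hEq t ht
    simp only [g]
    field_simp
    linear_combination -f₀ t * e
  have hWint : IntegrableOn W (Ioi 0) :=
    ((hfL.integrable_mul huL').sub (hgL.integrable_mul huL)).const_mul (h ^ 2)
  have hWint' : IntegrableOn (fun t => (h - mu) * (f₀ t * u₀ t)) (Ioi 0) :=
    (hfL.integrable_mul huL).const_mul (h - mu)
  have hW0 : ContinuousWithinAt W (Ici 0) 0 :=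
    ((((hf 0).continuousAt.mul hu₀'.continuous.continuousAt).sub
      ((hg 0).continuousAt.mul hu₀.continuous.continuousAt)).const_mul
        (h ^ 2)).continuousWithinAt
  have key := integral_Ioi_of_hasDerivAt_of_tendsto hW0 hW hWint'
    (tendsto_zero_of_hasDerivAt_of_integrableOn_Ioi hW hWint' hWint)
  rw [integral_const_mul] at key
  rw [(hf 0).deriv]
  constructor
  · rw [key]
    simp only [W, hNeu]
    ring
  · simp only [g, hf₀, zero_add]
    ring
end

section
/- Fix δ > 0 and C > 1 + δ. For every ε > 0 there exists h₀ > 0 such that for all h ∈ (0, h₀] and all m ∈ ℕ with r* := √(2mh) ∈ [1+δ, C], one has |∫₁^∞ r^{2m+1} e^{−r²/(2h)} dr / (√(πh) · r* · e^{−φ(r*)/(2h)}) − 1| ≤ ε, where φ(r*) = r*² − 2 r*² ln r*. That is, ∫₁^∞ r^{2m} e^{−r²/(2h)} r dr ∼ √(πh) r* e^{−φ(r*)/(2h)} as h → 0, uniformly for r* in compact subsets of (1,∞). -/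
open MeasureTheory Set

open scoped Nat

theorem integrableOn_pow_mul_exp_neg_sq_div (m : ℕ) {h : ℝ} (hh : 0 < h) :
    IntegrableOn (fun r : ℝ => r ^ (2 * m + 1) * Real.exp (-r ^ 2 / (2 * h))) (Ioi 0) := by
  have key := integrableOn_rpow_mul_exp_neg_mul_sq (b := 1 / (2 * h)) (by positivity)
    (s := ((2 * m + 1 : ℕ) : ℝ)) (by push_cast; linarith [(Nat.cast_nonneg m : (0 : ℝ) ≤ m)])
  refine key.congr_fun (fun r _ => ?_) measurableSet_Ioi
  simp only [Real.rpow_natCast]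
  congr 2
  ring

theorem integral_Ioi_pow_mul_exp_neg_sq_div (m : ℕ) {h : ℝ} (hh : 0 < h) :
    ∫ r in Ioi (0 : ℝ), r ^ (2 * m + 1) * Real.exp (-r ^ 2 / (2 * h)) =
      (2 * h) ^ (m + 1) * m ! / 2 := by
  have key := integral_rpow_mul_exp_neg_mul_rpow (p := ((2 : ℕ) : ℝ))
    (q := ((2 * m + 1 : ℕ) : ℝ)) (b := 1 / (2 * h)) (by norm_num)
    (by push_cast; linarith [(Nat.cast_nonneg m : (0 : ℝ) ≤ m)]) (by positivity)
  have e : (((2 * m + 1 : ℕ) : ℝ) + 1) / ((2 : ℕ) : ℝ) = m + 1 := by push_cast; ring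
  have e' : -(((2 * m + 1 : ℕ) : ℝ) + 1) / ((2 : ℕ) : ℝ) = -((m + 1 : ℕ) : ℝ) := by
    push_cast; ring
  rw [e, e', Real.Gamma_nat_eq_factorial, Real.rpow_neg (by positivity)] at key
  simp only [Real.rpow_natCast] at key
  rw [one_div_pow, inv_div, div_one] at key
  calc _ = ∫ r in Ioi (0 : ℝ), r ^ (2 * m + 1) * Real.exp (-(1 / (2 * h)) * r ^ 2) := by
        congr 1; ext r; congr 2; ring
    _ = _ := key
    _ = _ := by push_cast; ring

theorem pow_mul_exp_neg_sq_div_le (m : ℕ) {h r : ℝ} (hh : 0 < h) (hm : 1 ≤ 2 * m * h)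
    (hr : r ∈ Icc (0 : ℝ) 1) :
    r ^ (2 * m + 1) * Real.exp (-r ^ 2 / (2 * h)) ≤ Real.exp (-1 / (2 * h)) := by
  obtain ⟨h0, h1⟩ := hr
  have hs : r ^ 2 ≤ 1 := pow_le_one₀ h0 h1
  have hsexp : r ^ 2 ≤ Real.exp (r ^ 2 - 1) := by linarith [Real.add_one_le_exp (r ^ 2 - 1)]
  have hpow : r ^ (2 * m + 1) ≤ Real.exp (m * (r ^ 2 - 1)) := by
    rw [Real.exp_nat_mul]
    calc r ^ (2 * m + 1) ≤ r ^ (2 * m) := pow_le_pow_of_le_one h0 h1 (Nat.le_succ _)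
      _ = (r ^ 2) ^ m := pow_mul _ _ _
      _ ≤ _ := by gcongr
  calc _ ≤ Real.exp (m * (r ^ 2 - 1)) * Real.exp (-r ^ 2 / (2 * h)) := by gcongr
    _ = Real.exp (m * (r ^ 2 - 1) + -r ^ 2 / (2 * h)) := (Real.exp_add _ _).symm
    _ ≤ _ := by
      gcongr
      rw [le_div_iff₀ (by positivity), add_mul, div_mul_cancel₀ _ (by positivity)]
      nlinarith

theorem integral_Ioi_one_pow_mul_exp_neg_sq_div (m : ℕ) {h : ℝ} (hh : 0 < h)
    (hm : 1 ≤ 2 * m * h) :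
    |(∫ r in Ioi (1 : ℝ), r ^ (2 * m + 1) * Real.exp (-r ^ 2 / (2 * h))) -
      (2 * h) ^ (m + 1) * m ! / 2| ≤ Real.exp (-1 / (2 * h)) := by
  have hint := integrableOn_pow_mul_exp_neg_sq_div m hh
  have hsplit := setIntegral_union (μ := volume)
    (f := fun r : ℝ => r ^ (2 * m + 1) * Real.exp (-r ^ 2 / (2 * h)))
    (Ioc_disjoint_Ioi (le_refl (1 : ℝ)) (a := 0)) measurableSet_Ioi
    (hint.mono_set Ioc_subset_Ioi_self) (hint.mono_set (Ioi_subset_Ioi zero_le_one))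
  rw [Ioc_union_Ioi_eq_Ioi zero_le_one, integral_Ioi_pow_mul_exp_neg_sq_div m hh] at hsplit
  rw [hsplit, sub_add_cancel_right, abs_neg]
  have hb := norm_setIntegral_le_of_norm_le_const (μ := volume) (s := Ioc (0 : ℝ) 1)
    (f := fun r : ℝ => r ^ (2 * m + 1) * Real.exp (-r ^ 2 / (2 * h)))
    (C := Real.exp (-1 / (2 * h))) (by simp) (fun r hr => by
      have := hr.1
      rw [Real.norm_of_nonneg (by positivity)]
      exact pow_mul_exp_neg_sq_div_le m hh hm (Ioc_subset_Icc_self hr))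
  simpa using hb

theorem exp_laplace_phase (m : ℕ) {h : ℝ} (hh : 0 < h) (hm : 0 < m) :
    Real.exp (-(√(2 * m * h) ^ 2 - 2 * √(2 * m * h) ^ 2 * Real.log √(2 * m * h)) / (2 * h)) =
      (2 * m * h / Real.exp 1) ^ m := by
  have hR : 0 < 2 * m * h := by positivity
  rw [Real.sq_sqrt hR.le, Real.log_sqrt hR.le]
  have e : -(2 * m * h - 2 * (2 * m * h) * (Real.log (2 * m * h) / 2)) / (2 * h) =
      m * (Real.log (2 * m * h) - 1) := by
    field_simp
    ring
  rw [e, Real.exp_nat_mul, Real.exp_sub, Real.exp_log hR]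

theorem laplace_main_term_eq_stirlingSeq (m : ℕ) {h : ℝ} (hh : 0 < h) (hm : 0 < m) :
    (2 * h) ^ (m + 1) * m ! / 2 /
      (√(Real.pi * h) * √(2 * m * h) * (2 * m * h / Real.exp 1) ^ m) =
      Stirling.stirlingSeq m / √Real.pi := by
  have e : √(Real.pi * h) * √(2 * m * h) = h * √(2 * m) * √Real.pi := by
    rw [Real.sqrt_mul Real.pi_pos.le, Real.sqrt_mul (by positivity : (0 : ℝ) ≤ 2 * m)]
    linear_combination √Real.pi * √(2 * m) * Real.mul_self_sqrt hh.le
  have e' : (2 * m * h / Real.exp 1) ^ m = (2 * h) ^ m * (m / Real.exp 1) ^ m := by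
    rw [← mul_pow]; ring
  rw [e, e', Stirling.stirlingSeq, pow_succ]
  have : 0 < √(2 * m : ℝ) := by positivity
  have : 0 < √Real.pi := by positivity
  have : 0 < ((m : ℝ) / Real.exp 1) ^ m := by positivity
  have : 0 < (2 * h) ^ m := by positivity
  generalize ((m : ℝ) / Real.exp 1) ^ m = a at *
  generalize (2 * h) ^ m = b at *
  field_simp

theorem mul_log_sub_self_le_mul_log_sub_self {a b : ℝ} (ha : 1 ≤ a) (hab : a ≤ b) :
    a * Real.log a - a ≤ b * Real.log b - b := by
  have hb : 0 < b := by linarith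
  have hlog := Real.log_le_sub_one_of_pos (x := a / b) (by positivity)
  rw [Real.log_div (by positivity) (by positivity)] at hlog
  have hmul := mul_le_mul_of_nonneg_left hlog hb.le
  rw [mul_sub, mul_sub, mul_div_cancel₀ _ hb.ne'] at hmul
  nlinarith [Real.log_nonneg ha]

theorem mul_log_sub_self_add_one_pos {a : ℝ} (ha : 1 < a) : 0 < a * Real.log a - a + 1 := by
  have ha0 : 0 < a := by linarith
  have hlog := Real.log_lt_sub_one_of_pos (x := a⁻¹) (by positivity) (inv_ne_one.mpr ha.ne')
  rw [Real.log_inv] at hlog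
  have hmul := mul_lt_mul_of_pos_left hlog ha0
  rw [mul_sub, mul_inv_cancel₀ ha0.ne'] at hmul
  linarith

theorem exp_neg_div_laplace_denominator_le (m : ℕ) {h a : ℝ} (hh : 0 < h) (hm : 0 < m)
    (ha : 1 < a) (hma : a ≤ 2 * m * h) :
    Real.exp (-1 / (2 * h)) /
      (√(Real.pi * h) * √(2 * m * h) * (2 * m * h / Real.exp 1) ^ m) ≤
      2 * √h / (a * Real.log a - a + 1) := by
  have hR : 0 < 2 * m * h := by positivity
  have hc := mul_log_sub_self_add_one_pos ha
  have hmono := mul_log_sub_self_le_mul_log_sub_self ha.le hma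
  set c := a * Real.log a - a + 1 with hcdef
  have hpow : (2 * m * h / Real.exp 1) ^ m = Real.exp (m * (Real.log (2 * m * h) - 1)) := by
    rw [Real.exp_nat_mul, Real.exp_sub, Real.exp_log hR]
  have hexp : c / (2 * h) * Real.exp (-1 / (2 * h)) ≤ (2 * m * h / Real.exp 1) ^ m := by
    rw [hpow]
    calc _ ≤ Real.exp (c / (2 * h)) * Real.exp (-1 / (2 * h)) := by
          gcongr
          linarith [Real.add_one_le_exp (c / (2 * h))]
      _ = Real.exp (c / (2 * h) + -1 / (2 * h)) := (Real.exp_add _ _).symm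
      _ ≤ _ := by
          gcongr
          rw [← add_div, div_le_iff₀ (by positivity)]
          linarith
  have hsqrt : √h ≤ √(Real.pi * h) * √(2 * m * h) := by
    have h1 : √h ≤ √(Real.pi * h) :=
      Real.sqrt_le_sqrt (by nlinarith [Real.pi_gt_three])
    have h2 : 1 ≤ √(2 * m * h) := Real.one_le_sqrt.mpr (by linarith)
    nlinarith [Real.sqrt_nonneg h]
  have hs : 0 < √h := Real.sqrt_pos.mpr hh
  rw [div_le_iff₀ (by positivity)]
  calc Real.exp (-1 / (2 * h))
      = 2 * √h / c * (√h * (c / (2 * h) * Real.exp (-1 / (2 * h)))) := by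
        have := Real.mul_self_sqrt hh.le
        field_simp
        linear_combination -this
    _ ≤ _ := by gcongr

theorem laplace_asymptotics_annulus_norm (δ C : ℝ) (hδ : 0 < δ) (hC : 1 + δ < C) :
    ∀ ε : ℝ, 0 < ε → ∃ h₀ : ℝ, 0 < h₀ ∧
      ∀ h : ℝ, h ∈ Set.Ioc 0 h₀ → ∀ m : ℕ,
        Real.sqrt (2 * m * h) ∈ Set.Icc (1 + δ) C →
        |(∫ r in Set.Ioi (1:ℝ), r ^ (2 * m + 1) * Real.exp (-r ^ 2 / (2 * h))) /
            (Real.sqrt (Real.pi * h) * Real.sqrt (2 * m * h) *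
              Real.exp (-(Real.sqrt (2 * m * h) ^ 2 -
                2 * Real.sqrt (2 * m * h) ^ 2 * Real.log (Real.sqrt (2 * m * h))) /
                (2 * h))) - 1| ≤ ε := by
  intro ε hε
  have ha : 1 < (1 + δ) ^ 2 := by nlinarith
  have hc := mul_log_sub_self_add_one_pos ha
  set a := (1 + δ) ^ 2
  set c := a * Real.log a - a + 1
  have hπ : 0 < √Real.pi := Real.sqrt_pos.mpr Real.pi_pos
  have hlim := Stirling.tendsto_stirlingSeq_sqrt_pi.div_const √Real.pi
  rw [div_self hπ.ne'] at hlim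
  obtain ⟨N, hN⟩ := Metric.tendsto_atTop.mp hlim (ε / 2) (by positivity)
  refine ⟨min (1 / (2 * (N + 1))) ((c * ε / 4) ^ 2), by positivity, ?_⟩
  rintro h ⟨hh, hle⟩ m ⟨hm1, -⟩
  obtain ⟨hle1, hle2⟩ := le_min_iff.mp hle
  have hma : a ≤ 2 * m * h := (Real.le_sqrt' (by linarith)).mp hm1
  have hNm : N + 1 ≤ m := by
    rw [le_div_iff₀ (by positivity)] at hle1
    have : ((N + 1 : ℕ) : ℝ) ≤ m := by
      push_cast
      by_contra! hlt
      nlinarith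
    exact_mod_cast this
  have hm : 0 < m := by omega
  have hD : 0 < √(Real.pi * h) * √(2 * m * h) * (2 * m * h / Real.exp 1) ^ m := by
    have := Real.pi_pos
    positivity
  rw [exp_laplace_phase m hh hm]
  have hmain := laplace_main_term_eq_stirlingSeq m hh hm
  have hrem := integral_Ioi_one_pow_mul_exp_neg_sq_div m hh (ha.le.trans hma)
  have hsmall := exp_neg_div_laplace_denominator_le m hh hm ha hma
  have hst := (hN m (by omega)).le
  rw [Real.dist_eq, ← hmain] at hst
  set D := √(Real.pi * h) * √(2 * m * h) * (2 * m * h / Real.exp 1) ^ m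
  set I := ∫ r in Ioi (1 : ℝ), r ^ (2 * m + 1) * Real.exp (-r ^ 2 / (2 * h))
  set J := (2 * h) ^ (m + 1) * (m ! : ℝ) / 2
  have hfirst : |I / D - J / D| ≤ ε / 2 := by
    rw [← sub_div, abs_div, abs_of_pos hD]
    refine (div_le_div_of_nonneg_right hrem hD.le).trans (hsmall.trans ?_)
    have : √h ≤ c * ε / 4 := (Real.sqrt_le_left (by positivity)).mpr hle2
    rw [div_le_iff₀ hc]
    linarith
  linarith [abs_sub_le (I / D) (J / D) 1]
end

section
/- Let h > 0, m ∈ ℕ, and let χ : ℝ → ℝ be continuously differentiable. Define u(r) = r^m e^{−r²/(4h)}, f(r) = ∫₁^r χ(ρ) ρ^{−1−2m} e^{ρ²/(2h)} dρ, and v = f·u on (0,∞). Then for all r > 0: −h²(v″(r) + v′(r)/r) + (mh/r − r/2)² v(r) − h v(r) = −h² χ′(r) r^{−m−1} e^{r²/(4h)}. -/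
open MeasureTheory Set intervalIntegral

/-- The logarithmic derivative of `x ^ n * exp (x ^ 2 / c)` is `n / x + 2 * x / c`. -/
theorem hasDerivAt_zpow_mul_exp_sq_div (n : ℤ) (c : ℝ) {r : ℝ} (hr : r ≠ 0) :
    HasDerivAt (fun x : ℝ => x ^ n * Real.exp (x ^ 2 / c))
      ((n / r + 2 * r / c) * (r ^ n * Real.exp (r ^ 2 / c))) r := by
  have hexp := (((hasDerivAt_id r).pow 2).div_const c).exp
  have hmul := (hasDerivAt_zpow n r (Or.inl hr)).mul hexp
  refine hmul.congr_deriv ?_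
  simp only [Pi.pow_apply, id, zpow_sub_one₀ hr]
  field_simp
  push_cast
  ring

/-- The fundamental theorem of calculus for an integrand continuous on the positive half-line. -/
theorem hasDerivAt_integral_one_of_continuousOn_Ioi {k : ℝ → ℝ}
    (hk : ContinuousOn k (Ioi 0)) {r : ℝ} (hr : 0 < r) :
    HasDerivAt (fun x => ∫ ρ in (1:ℝ)..x, k ρ) (k r) r := by
  have hsub : uIcc 1 r ⊆ Ioi 0 := fun x hx => lt_of_lt_of_le (lt_min one_pos hr) hx.1
  exact integral_hasDerivAt_right (hk.mono hsub).intervalIntegrable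
    (hk.stronglyMeasurableAtFilter isOpen_Ioi r hr) (hk.continuousAt (Ioi_mem_nhds hr))

theorem exterior_quasimode_equation (h : ℝ) (hh : 0 < h) (m : ℕ)
    (χ : ℝ → ℝ) (hχ : ContDiff ℝ 1 χ)
    (u f v : ℝ → ℝ)
    (hu : u = fun r => r ^ m * Real.exp (-r ^ 2 / (4 * h)))
    (hf : f = fun r => ∫ ρ in (1:ℝ)..r, χ ρ * ρ ^ (-1 - 2 * (m:ℤ)) * Real.exp (ρ ^ 2 / (2 * h)))
    (hv : v = fun r => f r * u r) :
    ∀ r : ℝ, 0 < r →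
      -h ^ 2 * (deriv (deriv v) r + deriv v r / r) +
          (m * h / r - r / 2) ^ 2 * v r - h * v r =
        -h ^ 2 * deriv χ r * r ^ (-(m:ℤ) - 1) * Real.exp (r ^ 2 / (4 * h)) := by
  subst hu hv
  set w : ℝ → ℝ := fun r => r ^ (-(m:ℤ) - 1) * Real.exp (r ^ 2 / (4 * h)) with hw
  set u : ℝ → ℝ := fun r => r ^ m * Real.exp (-r ^ 2 / (4 * h)) with hu
  have hu' : ∀ r, 0 < r → HasDerivAt u ((m / r - r / (2 * h)) * u r) r := by
    intro r hr
    have hzpow : u = fun x : ℝ => x ^ (m:ℤ) * Real.exp (x ^ 2 / (-(4 * h))) := by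
      funext x
      simp only [hu, zpow_natCast, neg_div, div_neg]
    rw [hzpow]
    refine (hasDerivAt_zpow_mul_exp_sq_div m (-(4 * h)) hr.ne').congr_deriv ?_
    congr 1
    push_cast
    field_simp
    ring
  have hw' : ∀ r, 0 < r → HasDerivAt w ((-(m + 1) / r + r / (2 * h)) * w r) r := by
    intro r hr
    refine (hasDerivAt_zpow_mul_exp_sq_div (-(m:ℤ) - 1) (4 * h) hr.ne').congr_deriv ?_
    congr 1
    push_cast
    field_simp
    ring
  set k : ℝ → ℝ := fun ρ => χ ρ * ρ ^ (-1 - 2 * (m:ℤ)) * Real.exp (ρ ^ 2 / (2 * h)) with hk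
  have hcont : ContinuousOn k (Ioi 0) :=
    (hχ.continuous.continuousOn.mul
      (continuousOn_id.zpow₀ _ fun x hx => Or.inl (ne_of_gt hx))).mul
      (by fun_prop)
  have hf' : ∀ r, 0 < r → HasDerivAt f (k r) r := fun r hr => by
    rw [hf]
    exact hasDerivAt_integral_one_of_continuousOn_Ioi hcont hr
  have hku : ∀ r, 0 < r → k r * u r = χ r * w r := by
    intro r hr
    have hpow : r ^ (-1 - 2 * (m:ℤ)) * r ^ m = r ^ (-(m:ℤ) - 1) := by
      rw [← zpow_natCast, ← zpow_add₀ hr.ne']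
      congr 1
      ring
    have hexp : Real.exp (r ^ 2 / (2 * h)) * Real.exp (-r ^ 2 / (4 * h)) =
        Real.exp (r ^ 2 / (4 * h)) := by
      rw [← Real.exp_add]
      congr 1
      field_simp
      ring
    simp only [hk, hu, hw, ← hpow, ← hexp]
    ring
  have hv' : ∀ r, 0 < r → HasDerivAt (fun r => f r * u r)
      (χ r * w r + (m / r - r / (2 * h)) * (f r * u r)) r := by
    intro r hr
    refine ((hf' r hr).mul (hu' r hr)).congr_deriv ?_
    rw [hku r hr]
    ring
  intro r hr
  have hχ' : HasDerivAt χ (deriv χ r) r :=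
    (hχ.differentiable one_ne_zero r).hasDerivAt
  have hcoef : HasDerivAt (fun x : ℝ => m / x - x / (2 * h)) (-m / r ^ 2 - 1 / (2 * h)) r := by
    refine (((hasDerivAt_inv hr.ne').const_mul (m:ℝ)).sub
      ((hasDerivAt_id r).div_const (2 * h))).congr_deriv ?_
    ring
  have hv'' : deriv (deriv fun r => f r * u r) r =
      deriv χ r * w r + χ r * ((-(m + 1) / r + r / (2 * h)) * w r) +
        ((-m / r ^ 2 - 1 / (2 * h)) * (f r * u r) + (m / r - r / (2 * h)) *
          (χ r * w r + (m / r - r / (2 * h)) * (f r * u r))) := by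
    have heq : deriv (fun r => f r * u r) =ᶠ[nhds r]
        fun r => χ r * w r + (m / r - r / (2 * h)) * (f r * u r) := by
      filter_upwards [Ioi_mem_nhds hr] with x hx using (hv' x hx).deriv
    rw [heq.deriv_eq]
    exact ((hχ'.mul (hw' r hr)).add (hcoef.mul (hv' r hr))).deriv
  rw [hv'', (hv' r hr).deriv, mul_assoc (-h ^ 2 * deriv χ r)]
  change _ = -h ^ 2 * deriv χ r * w r
  generalize w r = W
  beta_reduce
  generalize f r * u r = V
  field_simp
  ring
end
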